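/- For every integer n ≥ 1, the number X₁ of 1-dimensional subcubes contained in a uniformly random Boolean function of length n has mean μ = n·2^{n−1}/4, variance E[(X₁−μ)²] = n(2n+1)·2^n/32, and third central moment E[(X₁−μ)³] = 3n³·2^n/64. -/

import Mathlib

open Finset

/-- The number of 1-dimensional subcubes contained in a Boolean function `f ⊆ {0,1}^n`, i.e.
the number of unordered pairs `{u,v}` of points of `{0,1}^n` differing in exactly one coordinate
with `u ∈ f` and `v ∈ f` (counted as ordered pairs divided by two). -/
noncomputable def oneCubeCount (n : ℕ) (f : Finset (Fin n → Bool)) : ℝ :=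
  (((univ : Finset ((Fin n → Bool) × (Fin n → Bool))).filter
      (fun p => p.1 ∈ f ∧ p.2 ∈ f ∧
        ((univ : Finset (Fin n)).filter (fun i => p.1 i ≠ p.2 i)).card = 1)).card : ℝ) / 2

section Signs

variable {V : Type*} [DecidableEq V]

/-- The `±1`-valued indicator of a set. -/
noncomputable def signOf (f : Finset V) (v : V) : ℝ := if v ∈ f then 1 else -1

lemma signOf_mul_self (f : Finset V) (v : V) : signOf f v * signOf f v = 1 := by
  unfold signOf; split_ifs <;> norm_num

lemma signOf_symmDiff_of_mem {T : Finset V} {v : V} (hv : v ∈ T) (f : Finset V) :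
    signOf (symmDiff f T) v = -signOf f v := by
  by_cases h : v ∈ f <;> simp [signOf, Finset.mem_symmDiff, hv, h]

lemma signOf_symmDiff_of_notMem {T : Finset V} {v : V} (hv : v ∉ T) (f : Finset V) :
    signOf (symmDiff f T) v = signOf f v := by
  by_cases h : v ∈ f <;> simp [signOf, Finset.mem_symmDiff, hv, h]

variable [Fintype V]

lemma sum_eq_zero_of_symmDiff_neg (F : Finset V → ℝ) (T : Finset V)
    (h : ∀ f, F (symmDiff f T) = -F f) : ∑ f, F f = 0 := by
  have hT : Function.Involutive fun f : Finset V => symmDiff f T := fun f => by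
    simp
  have key : ∑ f, F (symmDiff f T) = ∑ f, F f := Equiv.sum_comp hT.toPerm F
  simp only [h, Finset.sum_neg_distrib] at key
  linarith

lemma sum_signOf_mul_signOf (a b : V) :
    ∑ f : Finset V, signOf f a * signOf f b =
      2 ^ Fintype.card V * if a = b then 1 else 0 := by
  split_ifs with h
  · subst h
    simp [signOf_mul_self]
  · rw [mul_zero]
    refine sum_eq_zero_of_symmDiff_neg _ {a} fun f => ?_
    rw [signOf_symmDiff_of_mem (by simp), signOf_symmDiff_of_notMem (by simp [Ne.symm h])]
    ring

lemma sum_signOf_four (a b : V) {u v : V} (huv : u ≠ v) :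
    ∑ f : Finset V, signOf f a * signOf f b * (signOf f u * signOf f v) =
      2 ^ Fintype.card V *
        ((if a = u then if b = v then 1 else 0 else 0) +
          if a = v then if b = u then 1 else 0 else 0) := by
  by_cases hau : a = u
  · subst hau
    have h (f : Finset V) : signOf f a * signOf f b * (signOf f a * signOf f v) =
        signOf f b * signOf f v := by
      linear_combination signOf f b * signOf f v * signOf_mul_self f a
    simp only [h, sum_signOf_mul_signOf, if_neg huv, if_true, add_zero]
  by_cases hav : a = v
  · subst hav
    have h (f : Finset V) : signOf f a * signOf f b * (signOf f u * signOf f a) =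
        signOf f b * signOf f u := by
      linear_combination signOf f b * signOf f u * signOf_mul_self f a
    simp only [h, sum_signOf_mul_signOf, if_neg hau, if_true, zero_add]
  by_cases hab : a = b
  · subst hab
    simp [signOf_mul_self, sum_signOf_mul_signOf, hau, hav, huv]
  · simp only [hau, hav, if_false, add_zero, mul_zero]
    refine sum_eq_zero_of_symmDiff_neg _ {a} fun f => ?_
    rw [signOf_symmDiff_of_mem (by simp), signOf_symmDiff_of_notMem (by simp [Ne.symm hab]),
      signOf_symmDiff_of_notMem (by simp [Ne.symm hau]),
      signOf_symmDiff_of_notMem (by simp [Ne.symm hav])]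
    ring

/-- The sum of all signs. -/
noncomputable def signSum (f : Finset V) : ℝ := ∑ v, signOf f v

/-- The quadratic form of `A` evaluated at the signs of `f`. -/
noncomputable def signForm (A : V → V → ℝ) (f : Finset V) : ℝ :=
  ∑ u, ∑ v, A u v * (signOf f u * signOf f v)

lemma signSum_symmDiff_univ (f : Finset V) : signSum (symmDiff f univ) = -signSum f := by
  simp only [signSum, signOf_symmDiff_of_mem (mem_univ _), Finset.sum_neg_distrib]

lemma signForm_symmDiff_univ (A : V → V → ℝ) (f : Finset V) :
    signForm A (symmDiff f univ) = signForm A f := by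
  simp only [signForm, signOf_symmDiff_of_mem (mem_univ _), neg_mul_neg]

lemma signForm_symmDiff_of_bipartite {A : V → V → ℝ} {T : Finset V}
    (hT : ∀ u v, A u v ≠ 0 → (u ∈ T ↔ v ∉ T)) (f : Finset V) :
    signForm A (symmDiff f T) = -signForm A f := by
  simp only [signForm, ← Finset.sum_neg_distrib]
  refine Finset.sum_congr rfl fun u _ => Finset.sum_congr rfl fun v _ => ?_
  by_cases hA : A u v = 0
  · simp [hA]
  have h := hT u v hA
  by_cases hv : v ∈ T
  · rw [signOf_symmDiff_of_mem hv, signOf_symmDiff_of_notMem (by tauto)]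
    ring
  · rw [signOf_symmDiff_of_notMem hv, signOf_symmDiff_of_mem (by tauto)]
    ring

lemma sum_signSum_sq :
    ∑ f : Finset V, signSum f ^ 2 = 2 ^ Fintype.card V * Fintype.card V := by
  simp only [signSum, sq, Finset.sum_mul_sum]
  rw [Finset.sum_comm]
  simp_rw [Finset.sum_comm (s := (univ : Finset (Finset V))), sum_signOf_mul_signOf]
  simp [mul_comm]

lemma sum_mul_signForm (A : V → V → ℝ) (F : Finset V → ℝ) :
    ∑ f, F f * signForm A f =
      ∑ u, ∑ v, A u v * ∑ f, F f * (signOf f u * signOf f v) := by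
  simp only [signForm, Finset.mul_sum]
  rw [Finset.sum_comm]
  refine Finset.sum_congr rfl fun u _ => ?_
  rw [Finset.sum_comm]
  exact Finset.sum_congr rfl fun v _ => Finset.sum_congr rfl fun f _ => by ring

lemma sum_signSum_sq_mul_signForm {A : V → V → ℝ} (hA : ∀ v, A v v = 0) :
    ∑ f, signSum f ^ 2 * signForm A f =
      2 ^ Fintype.card V * (2 * ∑ u, ∑ v, A u v) := by
  rw [sum_mul_signForm]
  simp only [Finset.mul_sum]
  refine Finset.sum_congr rfl fun u _ => Finset.sum_congr rfl fun v _ => ?_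
  by_cases huv : u = v
  · subst huv
    simp [hA]
  have h : ∑ f : Finset V, signSum f ^ 2 * (signOf f u * signOf f v) =
      2 ^ Fintype.card V * 2 := by
    simp only [signSum, sq, Finset.sum_mul_sum, Finset.sum_mul _ _ (_ * _)]
    rw [Finset.sum_comm]
    simp_rw [Finset.sum_comm (s := (univ : Finset (Finset V))), sum_signOf_four _ _ huv]
    rw [← one_add_one_eq_two]
    simp only [← Finset.mul_sum, Finset.sum_add_distrib]
    simp
  rw [← Finset.mul_sum, h]
  ring

lemma sum_signForm_sq {A : V → V → ℝ} (hA : ∀ v, A v v = 0) (hsymm : ∀ u v, A u v = A v u) :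
    ∑ f, signForm A f ^ 2 = 2 ^ Fintype.card V * (2 * ∑ u, ∑ v, A u v ^ 2) := by
  simp only [sq (signForm A _)]
  rw [sum_mul_signForm]
  simp only [Finset.mul_sum]
  refine Finset.sum_congr rfl fun u _ => Finset.sum_congr rfl fun v _ => ?_
  by_cases huv : u = v
  · subst huv
    simp [hA]
  have h : ∑ f : Finset V, signForm A f * (signOf f u * signOf f v) =
      2 ^ Fintype.card V * (A u v + A v u) := by
    simp_rw [mul_comm (signForm A _)]
    rw [sum_mul_signForm]
    simp_rw [mul_comm (signOf _ u * signOf _ v), sum_signOf_four _ _ huv, mul_left_comm (A _ _)]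
    simp only [← Finset.mul_sum, mul_add, Finset.sum_add_distrib]
    simp
  rw [← Finset.mul_sum, h, hsymm v u]
  ring

/-- The number of edges inside `f`, for the graph with adjacency matrix `A`. -/
noncomputable def edgeCount (A : V → V → ℝ) (f : Finset V) : ℝ :=
  (∑ u, ∑ v, A u v * ((if u ∈ f then 1 else 0) * if v ∈ f then 1 else 0)) / 2

lemma edgeCount_eq {A : V → V → ℝ} {d : ℝ} (hsymm : ∀ u v, A u v = A v u)
    (hd : ∀ u, ∑ v, A u v = d) (f : Finset V) :
    edgeCount A f = d * Fintype.card V / 8 + (2 * d * signSum f + signForm A f) / 8 := by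
  have hx (v : V) : (if v ∈ f then (1 : ℝ) else 0) = (1 + signOf f v) / 2 := by
    unfold signOf; split_ifs <;> norm_num
  have h₁ : ∑ u, ∑ v, A u v * signOf f u = d * signSum f := by
    simp_rw [← Finset.sum_mul, hd, ← Finset.mul_sum, signSum]
  have h₂ : ∑ u, ∑ v, A u v * signOf f v = d * signSum f := by
    rw [Finset.sum_comm, ← h₁]
    simp_rw [hsymm]
  have h₀ : ∑ u, ∑ v, A u v = d * Fintype.card V := by simp [hd, mul_comm]
  have h : ∑ u, ∑ v, A u v * ((1 + signOf f u) / 2 * ((1 + signOf f v) / 2)) =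
      (∑ u, ∑ v, A u v + ∑ u, ∑ v, A u v * signOf f u + ∑ u, ∑ v, A u v * signOf f v +
        signForm A f) / 4 := by
    simp only [signForm, ← Finset.sum_add_distrib, Finset.sum_div]
    exact Finset.sum_congr rfl fun u _ => Finset.sum_congr rfl fun v _ => by ring
  simp_rw [edgeCount, hx]
  rw [h, h₀, h₁, h₂]
  ring

/-- The first three central moments of the number of edges of a regular bipartite graph inside
a uniformly random set of vertices. -/
theorem edgeCount_moments {A : V → V → ℝ} {d : ℝ} {T : Finset V}
    (hsymm : ∀ u v, A u v = A v u) (hsq : ∀ u v, A u v ^ 2 = A u v)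
    (hd : ∀ u, ∑ v, A u v = d) (hT : ∀ u v, A u v ≠ 0 → (u ∈ T ↔ v ∉ T)) :
    ∑ f, edgeCount A f = 2 ^ Fintype.card V * (d * Fintype.card V / 8) ∧
    ∑ f, (edgeCount A f - d * Fintype.card V / 8) ^ 2 =
      2 ^ Fintype.card V * (d * (2 * d + 1) * Fintype.card V / 32) ∧
    ∑ f, (edgeCount A f - d * Fintype.card V / 8) ^ 3 =
      2 ^ Fintype.card V * (3 * d ^ 3 * Fintype.card V / 64) := by
  have hA (v : V) : A v v = 0 := by
    by_contra h
    have := hT v v h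
    tauto
  have hsum : ∑ u, ∑ v, A u v = d * Fintype.card V := by simp [hd, mul_comm]
  have hL : ∑ f : Finset V, signSum f = 0 :=
    sum_eq_zero_of_symmDiff_neg _ univ signSum_symmDiff_univ
  have hQ : ∑ f, signForm A f = 0 :=
    sum_eq_zero_of_symmDiff_neg _ T (signForm_symmDiff_of_bipartite hT)
  have hLQ : ∑ f, signSum f * signForm A f = 0 :=
    sum_eq_zero_of_symmDiff_neg _ univ fun f => by
      rw [signSum_symmDiff_univ, signForm_symmDiff_univ, neg_mul]
  have hL3 : ∑ f : Finset V, signSum f ^ 3 = 0 :=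
    sum_eq_zero_of_symmDiff_neg _ univ fun f => by
      rw [signSum_symmDiff_univ]; ring
  have hLQ2 : ∑ f, signSum f * signForm A f ^ 2 = 0 :=
    sum_eq_zero_of_symmDiff_neg _ univ fun f => by
      rw [signSum_symmDiff_univ, signForm_symmDiff_univ, neg_mul]
  have hQ3 : ∑ f, signForm A f ^ 3 = 0 :=
    sum_eq_zero_of_symmDiff_neg _ T fun f => by
      rw [signForm_symmDiff_of_bipartite hT]; ring
  have hQ2 := sum_signForm_sq hA hsymm
  have hL2Q := sum_signSum_sq_mul_signForm hA
  simp only [hsq, hsum] at hQ2 hL2Q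
  simp only [edgeCount_eq hsymm hd, add_sub_cancel_left]
  refine ⟨?_, ?_, ?_⟩
  · simp [Finset.sum_add_distrib, ← Finset.sum_div, ← Finset.mul_sum, hL, hQ]
  · have h (f : Finset V) : ((2 * d * signSum f + signForm A f) / 8) ^ 2 =
        d ^ 2 / 16 * signSum f ^ 2 + d / 16 * (signSum f * signForm A f) +
          1 / 64 * signForm A f ^ 2 := by ring
    simp only [h, Finset.sum_add_distrib, ← Finset.mul_sum, hLQ, hQ2, sum_signSum_sq]
    ring
  · have h (f : Finset V) : ((2 * d * signSum f + signForm A f) / 8) ^ 3 =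
        d ^ 3 / 64 * signSum f ^ 3 + 3 * d ^ 2 / 128 * (signSum f ^ 2 * signForm A f) +
          3 * d / 256 * (signSum f * signForm A f ^ 2) + 1 / 512 * signForm A f ^ 3 := by ring
    simp only [h, Finset.sum_add_distrib, ← Finset.mul_sum, hL3, hL2Q, hLQ2, hQ3]
    ring

end Signs

section Cube

variable {n : ℕ}

/-- The set of coordinates in which two points of the cube differ. -/
def diffCoords (u v : Fin n → Bool) : Finset (Fin n) := {i | u i ≠ v i}

/-- The adjacency matrix of the `n`-cube. -/
noncomputable def cubeAdj (u v : Fin n → Bool) : ℝ := if (diffCoords u v).card = 1 then 1 else 0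

lemma diffCoords_eq_singleton_iff (u v : Fin n → Bool) (i : Fin n) :
    diffCoords u v = {i} ↔ v = Function.update u i (!u i) := by
  simp only [Finset.ext_iff, diffCoords, mem_filter_univ, mem_singleton, funext_iff]
  refine forall_congr' fun j => ?_
  by_cases h : j = i
  · subst h
    cases u j <;> cases v j <;> simp
  · simp [h, eq_comm]

lemma sum_cubeAdj (u : Fin n → Bool) : ∑ v, cubeAdj u v = n := by
  have hinj : Function.Injective fun i => Function.update u i (!u i) := fun i j hij => by
    have hi := (diffCoords_eq_singleton_iff u _ i).2 rfl
    have hj := (diffCoords_eq_singleton_iff u _ j).2 hij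
    exact Finset.singleton_injective (hi.symm.trans hj)
  have h : ({v | (diffCoords u v).card = 1} : Finset (Fin n → Bool)) =
      univ.image fun i => Function.update u i (!u i) := by
    ext v
    simp [Finset.card_eq_one, diffCoords_eq_singleton_iff, eq_comm]
  simp [cubeAdj, h, Finset.card_image_of_injective _ hinj]

/-- The points of the cube with an even number of coordinates equal to `true`. -/
def evenPoints (n : ℕ) : Finset (Fin n → Bool) := {u | Even (#{i | u i = true})}

lemma mem_evenPoints_iff_of_cubeAdj (u v : Fin n → Bool) (h : cubeAdj u v ≠ 0) :
    u ∈ evenPoints n ↔ v ∉ evenPoints n := by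
  obtain ⟨i, hi⟩ : ∃ i, diffCoords u v = {i} := by
    rw [← Finset.card_eq_one]
    by_contra h'
    exact h (if_neg h')
  rw [diffCoords_eq_singleton_iff] at hi
  have hcard (w : Fin n → Bool) : #{j | w j = true} =
      (if w i = true then 1 else 0) + ∑ j ∈ univ.erase i, if w j = true then 1 else 0 := by
    rw [Finset.card_filter, Finset.add_sum_erase _ (fun j => if w j = true then 1 else 0) (mem_univ i)]
  have hrest : (∑ j ∈ univ.erase i, if v j = true then 1 else 0) =
      ∑ j ∈ univ.erase i, if u j = true then 1 else 0 :=
    Finset.sum_congr rfl fun j hj => by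
      rw [hi, Function.update_of_ne (Finset.ne_of_mem_erase hj)]
  have hvi : v i = !u i := by rw [hi, Function.update_self]
  simp only [evenPoints, mem_filter_univ, hcard, hrest, hvi]
  cases u i <;> simp [Nat.even_add, parity_simps]

lemma oneCubeCount_eq_edgeCount (f : Finset (Fin n → Bool)) :
    oneCubeCount n f = edgeCount cubeAdj f := by
  rw [oneCubeCount, edgeCount, Finset.card_filter, Fintype.sum_prod_type]
  push_cast
  congr 1
  refine Finset.sum_congr rfl fun u _ => Finset.sum_congr rfl fun v _ => ?_
  simp only [cubeAdj, diffCoords]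
  split_ifs <;> simp_all
  tauto

end Cube

/-- For `n ≥ 1`, the number `X₁` of 1-dimensional subcubes of a uniformly random Boolean
function of length `n` has mean `μ = n·2^{n−1}/4`, variance `E[(X₁−μ)²] = n(2n+1)·2^n/32`, and
third central moment `E[(X₁−μ)³] = 3n³·2^n/64`. -/
theorem oneCube_mean_var_third (n : ℕ) (hn : 1 ≤ n) :
    (1 / (2 : ℝ) ^ (2 ^ n)) * ∑ f : Finset (Fin n → Bool), oneCubeCount n f =
        (n : ℝ) * 2 ^ (n - 1) / 4 ∧
    (1 / (2 : ℝ) ^ (2 ^ n)) * ∑ f : Finset (Fin n → Bool),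
        (oneCubeCount n f - (n : ℝ) * 2 ^ (n - 1) / 4) ^ 2 =
        (n : ℝ) * (2 * (n : ℝ) + 1) * 2 ^ n / 32 ∧
    (1 / (2 : ℝ) ^ (2 ^ n)) * ∑ f : Finset (Fin n → Bool),
        (oneCubeCount n f - (n : ℝ) * 2 ^ (n - 1) / 4) ^ 3 =
        3 * (n : ℝ) ^ 3 * 2 ^ n / 64 := by
  have hsymm (u v : Fin n → Bool) : cubeAdj u v = cubeAdj v u := by
    have h : diffCoords u v = diffCoords v u := by
      ext i
      simp [diffCoords, eq_comm]
    rw [cubeAdj, cubeAdj, h]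
  have hsq (u v : Fin n → Bool) : cubeAdj u v ^ 2 = cubeAdj u v := by
    unfold cubeAdj; split_ifs <;> norm_num
  obtain ⟨h₁, h₂, h₃⟩ := edgeCount_moments hsymm hsq sum_cubeAdj mem_evenPoints_iff_of_cubeAdj
  have hcard : Fintype.card (Fin n → Bool) = 2 ^ n := by simp
  have hμ : (n : ℝ) * 2 ^ (n - 1) / 4 = n * (2 ^ n : ℕ) / 8 := by
    obtain ⟨m, rfl⟩ := Nat.exists_eq_add_of_le' hn
    rw [Nat.add_sub_cancel, Nat.cast_pow, pow_succ]
    push_cast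
    ring
  have hC : (2 : ℝ) ^ 2 ^ n ≠ 0 := by positivity
  rw [hcard] at h₁ h₂ h₃
  simp only [oneCubeCount_eq_edgeCount, hμ, h₁, h₂, h₃, one_div, inv_mul_cancel_left₀ hC]
  simp
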